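/- arXiv:1412.4732 — 3 statements merged into one kernel-verified Lean document; each statement's English description precedes it below -/
import Mathlib

section
/- Let d ≥ 1, 1 < p < ∞, δ ∈ ℝ, let m ≥ 0 be an integer with mp > d, and let k be a nonnegative integer with k < m − d/p. Then there exists a constant C = C(d,m,p,k,δ) such that for all R > 0, all f ∈ C^m(ℝ^d), and all multi-indices α with |α| ≤ k, sup_{x ∈ A_R} |x|^{δ+|α|} |D^α f(x)| ≤ C · Σ_{j=0}^{m} (∫_{A_R} (|x|^{δ−d/p+j} |∇^j f(x)|)^p dx)^{1/p}, where A_R = {x ∈ ℝ^d : R < |x| < 2R}. In particular the constant C is independent of R. -/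
open MeasureTheory Filter
open scoped BigOperators ENNReal Topology

noncomputable section

/-- The Japanese bracket `⟨x⟩ = (1+|x|²)^{1/2}`. -/
def jb {d : ℕ} (x : EuclideanSpace ℝ (Fin d)) : ℝ := Real.sqrt (1 + ‖x‖ ^ 2)

/-- The partial derivative in the `i`-th coordinate direction. -/
def pd {d : ℕ} {F : Type*} [NormedAddCommGroup F] [NormedSpace ℝ F] (i : Fin d)
    (f : EuclideanSpace ℝ (Fin d) → F) : EuclideanSpace ℝ (Fin d) → F :=
  fun x => fderiv ℝ f x (EuclideanSpace.single i 1)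

/-- Iterated partial derivatives along a list of coordinate directions. -/
def pdList {d : ℕ} {F : Type*} [NormedAddCommGroup F] [NormedSpace ℝ F] :
    List (Fin d) → (EuclideanSpace ℝ (Fin d) → F) → EuclideanSpace ℝ (Fin d) → F
  | [], f => f
  | i :: l, f => pd i (pdList l f)

/-- The partial derivative `D^α f` corresponding to a multi-index `α : Fin d → ℕ`. -/
def mD {d : ℕ} {F : Type*} [NormedAddCommGroup F] [NormedSpace ℝ F] (α : Fin d → ℕ)
    (f : EuclideanSpace ℝ (Fin d) → F) : EuclideanSpace ℝ (Fin d) → F :=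
  pdList ((List.finRange d).flatMap fun i => List.replicate (α i) i) f

/-- The order `|α|` of a multi-index. -/
def msize {d : ℕ} (α : Fin d → ℕ) : ℕ := ∑ i, α i

/-- The finset of all multi-indices on `ℝ^d` of order at most `m`. -/
def mIdx (d m : ℕ) : Finset (Fin d → ℕ) :=
  (Fintype.piFinset fun _ : Fin d => Finset.range (m + 1)).filter fun α => msize α ≤ m

section

variable {E F : Type*} [NormedAddCommGroup E] [NormedSpace ℝ E]
  [NormedAddCommGroup F] [NormedSpace ℝ F]

/-- The Taylor formula at `x` around `y`, as a bound with integral remainder. -/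
theorem enorm_le_sum_add_lintegral_iteratedFDeriv [CompleteSpace F] {n : ℕ} {f : E → F}
    (hf : ContDiff ℝ (n + 1) f) (x y : E) :
    ‖f x‖ₑ ≤ ∑ j ∈ Finset.range (n + 1), ‖y - x‖ₑ ^ j * ‖iteratedFDeriv ℝ j f y‖ₑ +
      ∫⁻ s in Set.Ioc (0 : ℝ) 1, ENNReal.ofReal (s ^ n) *
        (‖y - x‖ₑ ^ (n + 1) * ‖iteratedFDeriv ℝ (n + 1) f (x + s • (y - x))‖ₑ) := by
  have key (j : ℕ) (z : E) : ‖iteratedFDeriv ℝ j f z (fun _ ↦ x - y)‖ₑ ≤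
      ‖y - x‖ₑ ^ j * ‖iteratedFDeriv ℝ j f z‖ₑ := by
    have h := (iteratedFDeriv ℝ j f z).le_opNorm (fun _ ↦ x - y)
    rw [Fin.prod_const, norm_sub_rev x y, mul_comm] at h
    simp_rw [← ofReal_norm]
    rw [← ENNReal.ofReal_pow (norm_nonneg _), ← ENNReal.ofReal_mul (pow_nonneg (norm_nonneg _) _)]
    gcongr
  have fact (j : ℕ) : ‖(j.factorial : ℝ)⁻¹‖ₑ ≤ 1 := by
    rw [← ofReal_norm, ENNReal.ofReal_le_one, Real.norm_of_nonneg (by positivity)]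
    exact inv_le_one_of_one_le₀ (mod_cast Nat.factorial_pos j)
  have h := map_add_eq_sum_add_integral_iteratedFDeriv (x := y) (y := x - y) (n := n) (f := f)
    (fun t _ ↦ hf.contDiffAt)
  rw [add_sub_cancel] at h
  rw [h]
  refine (enorm_add_le _ _).trans (add_le_add ((enorm_sum_le _ _).trans ?_) ?_)
  · refine Finset.sum_le_sum fun j _ ↦ ?_
    rw [enorm_smul]
    exact (mul_le_of_le_one_left' (fact j)).trans (key j y)
  · rw [enorm_smul]
    refine (mul_le_of_le_one_left' (fact n)).trans ?_
    have h2 := intervalIntegral.integral_comp_sub_left (a := 0) (b := 1)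
      (fun s : ℝ ↦ s ^ n • iteratedFDeriv ℝ (n + 1) f (x + s • (y - x)) (fun _ ↦ x - y)) 1
    have h3 (t : ℝ) : x + (1 - t) • (y - x) = y + t • (x - y) := by module
    simp only [h3, sub_self, sub_zero] at h2
    rw [h2, intervalIntegral.integral_of_le zero_le_one]
    refine (enorm_integral_le_lintegral_enorm _).trans ?_
    refine setLIntegral_mono' measurableSet_Ioc fun s hs ↦ ?_
    rw [enorm_smul, Real.enorm_of_nonneg (pow_nonneg hs.1.le _)]
    gcongr
    exact key _ _

theorem norm_homothety_mem_annulus {R : ℝ} {x y : E} (hx : R < ‖x‖) (hx' : ‖x‖ < 2 * R)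
    (hy : y ∈ Metric.ball ((3 / 2 * R / ‖x‖) • x) (R / 2)) {s : ℝ} (hs : s ∈ Set.Ioc (0 : ℝ) 1) :
    R < ‖x + s • (y - x)‖ ∧ ‖x + s • (y - x)‖ < 2 * R := by
  obtain ⟨hs0, hs1⟩ := hs
  have hR : 0 < R := by linarith [norm_nonneg x]
  have hx0 : 0 < ‖x‖ := hR.trans hx
  rw [mem_ball_iff_norm] at hy
  set c := (3 / 2 * R / ‖x‖) • x with hc
  have hz : x + s • (y - x) = ((1 - s) + s * (3 / 2 * R / ‖x‖)) • x + s • (y - c) := by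
    rw [hc]
    module
  have hn : ‖((1 - s) + s * (3 / 2 * R / ‖x‖)) • x‖ = (1 - s) * ‖x‖ + s * (3 / 2 * R) := by
    have : 0 ≤ 1 - s := by linarith
    rw [norm_smul, Real.norm_of_nonneg (by positivity)]
    field_simp
  have hn' : ‖s • (y - c)‖ < s * (R / 2) := by
    rw [norm_smul, Real.norm_of_nonneg hs0.le]
    gcongr
  have h1 := norm_add_le (((1 - s) + s * (3 / 2 * R / ‖x‖)) • x) (s • (y - c))
  have h2 := norm_le_norm_add_norm_sub' (((1 - s) + s * (3 / 2 * R / ‖x‖)) • x) (-(s • (y - c)))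
  rw [norm_neg, sub_neg_eq_add] at h2
  rw [hz]
  constructor <;> nlinarith

theorem norm_sub_le_of_mem_ball_annulus {R : ℝ} {x y : E} (hx : R < ‖x‖) (hx' : ‖x‖ < 2 * R)
    (hy : y ∈ Metric.ball ((3 / 2 * R / ‖x‖) • x) (R / 2)) : ‖y - x‖ ≤ R := by
  have hx0 : 0 < ‖x‖ := by linarith [norm_nonneg x]
  rw [mem_ball_iff_norm] at hy
  have h : ‖(3 / 2 * R / ‖x‖) • x - x‖ ≤ R / 2 := by
    have e : (3 / 2 * R / ‖x‖) • x - x = ((3 / 2 * R - ‖x‖) / ‖x‖) • x := by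
      rw [sub_div, div_self hx0.ne']
      module
    rw [e, norm_smul, norm_div, norm_norm, div_mul_cancel₀ _ hx0.ne', Real.norm_eq_abs, abs_le]
    constructor <;> linarith
  linarith [norm_sub_le_norm_sub_add_norm_sub y ((3 / 2 * R / ‖x‖) • x) x]

theorem Real.rpow_le_two_rpow_abs_mul {R t : ℝ} (hR : 0 < R) (h1 : R ≤ t) (h2 : t ≤ 2 * R)
    (e : ℝ) : t ^ e ≤ 2 ^ |e| * R ^ e := by
  have ht : t = (t / R) * R := by field_simp
  have h3 : 1 ≤ t / R := (one_le_div hR).2 h1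
  have h4 : t / R ≤ 2 := (div_le_iff₀ hR).2 h2
  rw [ht, Real.mul_rpow (by positivity) hR.le]
  gcongr
  calc (t / R) ^ e ≤ (t / R) ^ |e| := Real.rpow_le_rpow_of_exponent_le h3 (le_abs_self e)
    _ ≤ 2 ^ |e| := Real.rpow_le_rpow (by positivity) h4 (abs_nonneg e)

variable [MeasurableSpace E] [BorelSpace E] [FiniteDimensional ℝ E]

theorem lintegral_comp_homothety (μ : Measure E) [μ.IsAddHaarMeasure] {g : E → ℝ≥0∞}
    (hg : Measurable g) (x : E) {s : ℝ} (hs : 0 < s) :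
    ∫⁻ y, g (x + s • (y - x)) ∂μ =
      ENNReal.ofReal (s ^ Module.finrank ℝ E)⁻¹ * ∫⁻ y, g y ∂μ := by
  rw [lintegral_sub_right_eq_self (fun y ↦ g (x + s • y)) x,
    ← lintegral_map (f := fun z ↦ g (x + z)) (g := fun y : E ↦ s • y) (by fun_prop) (by fun_prop),
    Measure.map_addHaar_smul μ hs.ne', lintegral_smul_measure, lintegral_add_left_eq_self,
    abs_of_nonneg (by positivity), smul_eq_mul]

theorem setLIntegral_le_measure_rpow_mul {α : Type*} [MeasurableSpace α] (μ : Measure α)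
    {p : ℝ} (hp : 1 < p) (s : Set α) {g : α → ℝ≥0∞} (hg : Measurable g) :
    ∫⁻ y in s, g y ∂μ ≤ μ s ^ (1 - 1 / p) * (∫⁻ y in s, g y ^ p ∂μ) ^ (1 / p) := by
  have h := ENNReal.lintegral_mul_le_Lp_mul_Lq (μ.restrict s)
    (Real.HolderConjugate.conjExponent hp).symm
    (f := fun _ ↦ 1) (g := g) aemeasurable_const hg.aemeasurable
  have e : 1 / p.conjExponent = 1 - 1 / p := by
    rw [Real.conjExponent]
    field_simp
  simpa [e] using h

/-- The Sobolev averaging argument: a pointwise bound by `L^p` norms over a set `A` which contains all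
segments from `x` (excluded) to points of `B`. -/
theorem enorm_le_measure_rpow_mul_sum_add [CompleteSpace F] (μ : Measure E) [μ.IsAddHaarMeasure]
    {p : ℝ} (hp : 1 < p) {n : ℕ} {f : E → F} (hf : ContDiff ℝ (n + 1) f) {A B : Set E}
    (hA : MeasurableSet A) (hB : MeasurableSet B) (hB0 : μ B ≠ 0) (hB' : μ B ≠ ∞) {x : E}
    {R : ℝ≥0∞} (hR : ∀ y ∈ B, ‖y - x‖ₑ ≤ R)
    (hAB : ∀ y ∈ B, ∀ s ∈ Set.Ioc (0 : ℝ) 1, x + s • (y - x) ∈ A) :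
    ‖f x‖ₑ ≤ μ B ^ (-(1 / p)) *
      (∑ j ∈ Finset.range (n + 1),
          R ^ j * (∫⁻ y in A, ‖iteratedFDeriv ℝ j f y‖ₑ ^ p ∂μ) ^ (1 / p) +
        (∫⁻ s in Set.Ioc (0 : ℝ) 1,
          ENNReal.ofReal (s ^ n) * ENNReal.ofReal (s ^ Module.finrank ℝ E)⁻¹ ^ (1 / p)) *
          (R ^ (n + 1) * (∫⁻ y in A, ‖iteratedFDeriv ℝ (n + 1) f y‖ₑ ^ p ∂μ) ^ (1 / p))) := by
  have hp0 : 0 < p := by linarith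
  have hBA : B ⊆ A := fun y hy ↦ by simpa using hAB y hy 1 (by simp)
  have hc (j : ℕ) (hj : j ≤ n + 1) : Continuous (iteratedFDeriv ℝ j f) :=
    hf.continuous_iteratedFDeriv (mod_cast hj)
  have hm (j : ℕ) (hj : j ≤ n + 1) : Measurable fun y ↦ ‖iteratedFDeriv ℝ j f y‖ₑ :=
    (hc j hj).enorm.measurable
  set a : ℕ → ℝ≥0∞ := fun j ↦ (∫⁻ y in A, ‖iteratedFDeriv ℝ j f y‖ₑ ^ p ∂μ) ^ (1 / p) with ha
  have low (j : ℕ) (hj : j ≤ n + 1) :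
      ∫⁻ y in B, ‖y - x‖ₑ ^ j * ‖iteratedFDeriv ℝ j f y‖ₑ ∂μ ≤
        μ B ^ (1 - 1 / p) * (R ^ j * a j) := by
    calc _ ≤ ∫⁻ y in B, R ^ j * ‖iteratedFDeriv ℝ j f y‖ₑ ∂μ :=
          setLIntegral_mono' hB fun y hy ↦ by gcongr; exact hR y hy
      _ = R ^ j * ∫⁻ y in B, ‖iteratedFDeriv ℝ j f y‖ₑ ∂μ := lintegral_const_mul _ (hm j hj)
      _ ≤ R ^ j * (μ B ^ (1 - 1 / p) * a j) := by
          gcongr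
          refine (setLIntegral_le_measure_rpow_mul μ hp B (hm j hj)).trans ?_
          simp only [ha]
          gcongr
      _ = _ := by ring
  have top (s : ℝ) (hs : s ∈ Set.Ioc (0 : ℝ) 1) :
      ∫⁻ y in B, ‖iteratedFDeriv ℝ (n + 1) f (x + s • (y - x))‖ₑ ∂μ ≤
        μ B ^ (1 - 1 / p) *
          (ENNReal.ofReal (s ^ Module.finrank ℝ E)⁻¹ ^ (1 / p) * a (n + 1)) := by
    refine (setLIntegral_le_measure_rpow_mul μ hp B
      ((hm _ le_rfl).comp (by fun_prop : Measurable fun y ↦ x + s • (y - x)))).trans ?_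
    rw [ha, ← ENNReal.mul_rpow_of_nonneg _ _ (by positivity)]
    gcongr
    rw [← lintegral_indicator hA, ← lintegral_comp_homothety μ
      (((hm _ le_rfl).pow_const p).indicator hA) x hs.1]
    refine le_trans (setLIntegral_mono' hB fun y hy ↦ ?_) (setLIntegral_le_lintegral B _)
    rw [Set.indicator_of_mem (hAB y hy s hs)]
    rfl
  have hjoint : Measurable fun q : E × ℝ ↦ ENNReal.ofReal (q.2 ^ n) *
      (‖q.1 - x‖ₑ ^ (n + 1) * ‖iteratedFDeriv ℝ (n + 1) f (x + q.2 • (q.1 - x))‖ₑ) := by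
    have h1 : Continuous fun q : E × ℝ ↦ iteratedFDeriv ℝ (n + 1) f (x + q.2 • (q.1 - x)) :=
      (hc _ le_rfl).comp (by fun_prop)
    have h2 := h1.enorm.measurable
    fun_prop
  have hmain : μ B * ‖f x‖ₑ ≤ μ B ^ (1 - 1 / p) * (∑ j ∈ Finset.range (n + 1), R ^ j * a j +
        (∫⁻ s in Set.Ioc (0 : ℝ) 1,
          ENNReal.ofReal (s ^ n) * ENNReal.ofReal (s ^ Module.finrank ℝ E)⁻¹ ^ (1 / p)) *
          (R ^ (n + 1) * a (n + 1))) := by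
    calc μ B * ‖f x‖ₑ = ∫⁻ y in B, ‖f x‖ₑ ∂μ := by rw [setLIntegral_const, mul_comm]
      _ ≤ ∫⁻ y in B, (∑ j ∈ Finset.range (n + 1), ‖y - x‖ₑ ^ j * ‖iteratedFDeriv ℝ j f y‖ₑ +
          ∫⁻ s in Set.Ioc (0 : ℝ) 1, ENNReal.ofReal (s ^ n) *
          (‖y - x‖ₑ ^ (n + 1) * ‖iteratedFDeriv ℝ (n + 1) f (x + s • (y - x))‖ₑ)) ∂μ :=
        lintegral_mono fun y ↦ enorm_le_sum_add_lintegral_iteratedFDeriv hf x y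
      _ = ∑ j ∈ Finset.range (n + 1), ∫⁻ y in B, ‖y - x‖ₑ ^ j * ‖iteratedFDeriv ℝ j f y‖ₑ ∂μ +
          ∫⁻ s in Set.Ioc (0 : ℝ) 1, ∫⁻ y in B, ENNReal.ofReal (s ^ n) *
          (‖y - x‖ₑ ^ (n + 1) * ‖iteratedFDeriv ℝ (n + 1) f (x + s • (y - x))‖ₑ) ∂μ := by
        have hlow (j : ℕ) (hj : j ∈ Finset.range (n + 1)) :
            Measurable fun y ↦ ‖y - x‖ₑ ^ j * ‖iteratedFDeriv ℝ j f y‖ₑ := by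
          have := hm j (Finset.mem_range.1 hj).le
          fun_prop
        rw [lintegral_add_left (Finset.measurable_fun_sum _ hlow),
          lintegral_finsetSum _ hlow]
        congr 1
        exact lintegral_lintegral_swap hjoint.aemeasurable
      _ ≤ ∑ j ∈ Finset.range (n + 1), μ B ^ (1 - 1 / p) * (R ^ j * a j) +
          ∫⁻ s in Set.Ioc (0 : ℝ) 1, (ENNReal.ofReal (s ^ n) *
            ENNReal.ofReal (s ^ Module.finrank ℝ E)⁻¹ ^ (1 / p)) *
            (μ B ^ (1 - 1 / p) * (R ^ (n + 1) * a (n + 1))) := by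
        refine add_le_add
          (Finset.sum_le_sum fun j hj ↦ low j (Finset.mem_range.1 hj).le)
          (setLIntegral_mono' measurableSet_Ioc fun s hs ↦ ?_)
        calc _ ≤ ∫⁻ y in B, (ENNReal.ofReal (s ^ n) * R ^ (n + 1)) *
              ‖iteratedFDeriv ℝ (n + 1) f (x + s • (y - x))‖ₑ ∂μ := by
              refine setLIntegral_mono' hB fun y hy ↦ ?_
              rw [mul_assoc]
              gcongr
              exact hR y hy
          _ = (ENNReal.ofReal (s ^ n) * R ^ (n + 1)) *
              ∫⁻ y in B, ‖iteratedFDeriv ℝ (n + 1) f (x + s • (y - x))‖ₑ ∂μ :=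
            lintegral_const_mul _
              ((hm _ le_rfl).comp (by fun_prop : Measurable fun y ↦ x + s • (y - x)))
          _ ≤ _ := by
            grw [top s hs]
            exact le_of_eq (by ring)
      _ = _ := by
        rw [lintegral_mul_const _ (by fun_prop), ← Finset.mul_sum]
        ring
  have h1 : μ B ^ (1 - 1 / p) = μ B * μ B ^ (-(1 / p)) := by
    rw [sub_eq_add_neg, ENNReal.rpow_add _ _ hB0 hB', ENNReal.rpow_one]
  rw [h1, mul_assoc] at hmain
  exact (ENNReal.mul_le_mul_iff_right hB0 hB').1 hmain

theorem lintegral_rpow_kernel_lt_top {n d : ℕ} {p : ℝ} (h : (d : ℝ) / p < n + 1) (hp : 0 < p) :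
    ∫⁻ s in Set.Ioc (0 : ℝ) 1,
      ENNReal.ofReal (s ^ n) * ENNReal.ofReal (s ^ d)⁻¹ ^ (1 / p) < ∞ := by
  have hi : IntegrableOn (fun s : ℝ ↦ s ^ ((n : ℝ) - d / p)) (Set.Ioc 0 1) :=
    (intervalIntegrable_iff_integrableOn_Ioc_of_le zero_le_one).1
      (intervalIntegral.intervalIntegrable_rpow' (by linarith))
  refine lt_of_eq_of_lt (setLIntegral_congr_fun measurableSet_Ioc fun s hs ↦ ?_)
    hi.lintegral_lt_top
  have hs := hs.1
  rw [ENNReal.ofReal_rpow_of_nonneg (by positivity) (by positivity),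
    ← ENNReal.ofReal_mul (by positivity), Real.rpow_sub hs, Real.rpow_natCast,
    Real.inv_rpow (by positivity), ← Real.rpow_natCast s d, ← Real.rpow_mul hs.le, mul_one_div,
    ← div_eq_mul_inv]

/-- On an annulus, an unweighted `L^p` norm is controlled by a power-weighted one. -/
theorem lintegral_annulus_le_weighted {F : Type*} [NormedAddCommGroup F] (μ : Measure E)
    [μ.IsAddHaarMeasure] {R p : ℝ} (hR : 0 < R) (hp : 0 < p) {g : E → F} (hg : Continuous g) (e : ℝ) :
    (∫⁻ y in {y : E | R < ‖y‖ ∧ ‖y‖ < 2 * R}, ‖g y‖ₑ ^ p ∂μ) ^ (1 / p) ≤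
      ENNReal.ofReal (2 ^ |e| * R ^ (-e) *
        (∫ y in {y : E | R < ‖y‖ ∧ ‖y‖ < 2 * R}, (‖y‖ ^ e * ‖g y‖) ^ p ∂μ) ^ (1 / p)) := by
  set A := {y : E | R < ‖y‖ ∧ ‖y‖ < 2 * R} with hA
  have hAm : MeasurableSet A :=
    (measurableSet_lt measurable_const measurable_norm).inter
      (measurableSet_lt measurable_norm measurable_const)
  have hcpt : IsCompact {y : E | R ≤ ‖y‖ ∧ ‖y‖ ≤ 2 * R} := by
    refine (isCompact_closedBall (0 : E) (2 * R)).of_isClosed_subset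
      ((isClosed_le continuous_const continuous_norm).inter
        (isClosed_le continuous_norm continuous_const)) fun y hy ↦ ?_
    simpa using hy.2
  have hcont : ContinuousOn (fun y : E ↦ (‖y‖ ^ e * ‖g y‖) ^ p)
      {y : E | R ≤ ‖y‖ ∧ ‖y‖ ≤ 2 * R} :=
    ((continuous_norm.continuousOn.rpow_const fun y hy ↦ Or.inl (hR.trans_le hy.1).ne').mul
      hg.norm.continuousOn).rpow_const fun _ _ ↦ Or.inr hp.le
  have hint : IntegrableOn (fun y : E ↦ (‖y‖ ^ e * ‖g y‖) ^ p) A μ :=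
    (hcont.integrableOn_compact hcpt).mono_set fun y hy ↦ ⟨hy.1.le, hy.2.le⟩
  have hpos : 0 ≤ ∫ y in A, (‖y‖ ^ e * ‖g y‖) ^ p ∂μ := integral_nonneg fun y ↦ by positivity
  rw [ENNReal.ofReal_mul (by positivity), ← ENNReal.ofReal_rpow_of_nonneg hpos (by positivity),
    ofReal_integral_eq_lintegral_ofReal hint (.of_forall fun y ↦ by positivity)]
  have hc : ENNReal.ofReal (2 ^ |e| * R ^ (-e)) =
      (ENNReal.ofReal (2 ^ |e| * R ^ (-e)) ^ p) ^ (1 / p) := by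
    rw [← ENNReal.rpow_mul, mul_one_div_cancel hp.ne', ENNReal.rpow_one]
  rw [hc, ← ENNReal.mul_rpow_of_nonneg _ _ (by positivity)]
  gcongr
  rw [← lintegral_const_mul' _ _ (by finiteness)]
  refine setLIntegral_mono' hAm fun y hy ↦ ?_
  rw [← ENNReal.ofReal_rpow_of_nonneg (by positivity) hp.le,
    ← ENNReal.mul_rpow_of_nonneg _ _ hp.le, ← ENNReal.ofReal_mul (by positivity), ← ofReal_norm]
  gcongr
  have hy0 : 0 < ‖y‖ := hR.trans hy.1
  have h := Real.rpow_le_two_rpow_abs_mul hR hy.1.le hy.2.le (-e)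
  rw [abs_neg] at h
  calc ‖g y‖ = ‖y‖ ^ (-e) * (‖y‖ ^ e * ‖g y‖) := by
        rw [← mul_assoc, ← Real.rpow_add hy0, neg_add_cancel, Real.rpow_zero, one_mul]
    _ ≤ _ := by gcongr

theorem ContDiff.pdList {d n : ℕ} {f : EuclideanSpace ℝ (Fin d) → F} {l : List (Fin d)}
    (hf : ContDiff ℝ (l.length + n : ℕ) f) : ContDiff ℝ n (pdList l f) := by
  induction l generalizing n with
  | nil => simpa [_root_.pdList] using hf
  | cons i l ih =>
    have h : ContDiff ℝ (n + 1 : ℕ) (_root_.pdList l f) :=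
      ih (by rwa [List.length_cons, add_right_comm] at hf)
    exact (h.fderiv_right (m := n) (by norm_cast)).clm_apply contDiff_const

theorem norm_iteratedFDeriv_pdList_le {d n : ℕ} {f : EuclideanSpace ℝ (Fin d) → F}
    {l : List (Fin d)} (hf : ContDiff ℝ (l.length + n : ℕ) f) (x : EuclideanSpace ℝ (Fin d)) :
    ‖iteratedFDeriv ℝ n (pdList l f) x‖ ≤ ‖iteratedFDeriv ℝ (l.length + n) f x‖ := by
  induction l generalizing n with
  | nil => rw [List.length_nil, zero_add, pdList]
  | cons i l ih =>
    rw [List.length_cons, add_right_comm] at hf ⊢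
    have h := norm_iteratedFDeriv_clm_apply_const (𝕜 := ℝ) (n := n) (x := x) (N := n)
      (c := EuclideanSpace.single i (1 : ℝ))
      ((hf.pdList (n := n + 1)).fderiv_right (m := n) (by norm_cast)).contDiffAt le_rfl
    rw [norm_iteratedFDeriv_fderiv, PiLp.norm_single, norm_one, one_mul] at h
    exact h.trans (ih (n := n + 1) hf)

theorem length_flatMap_replicate {d : ℕ} (α : Fin d → ℕ) :
    ((List.finRange d).flatMap fun i ↦ List.replicate (α i) i).length = msize α := by
  simp [List.length_flatMap, msize, Fin.sum_univ_def]

theorem enorm_le_rpow_mul_sum_add_of_mem_annulus [CompleteSpace F] {d n : ℕ} {p : ℝ} (hp : 1 < p)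
    {f : EuclideanSpace ℝ (Fin d) → F} (hf : ContDiff ℝ (n + 1) f) {R : ℝ}
    {x : EuclideanSpace ℝ (Fin d)} (hx : R < ‖x‖) (hx' : ‖x‖ < 2 * R) :
    ‖f x‖ₑ ≤ ENNReal.ofReal
      ((volume (Metric.ball (0 : EuclideanSpace ℝ (Fin d)) 1)).toReal ^ (-(1 / p)) *
        2 ^ ((d : ℝ) / p) * R ^ (-((d : ℝ) / p))) *
      (∑ j ∈ Finset.range (n + 1), ENNReal.ofReal R ^ j *
        (∫⁻ y in {y : EuclideanSpace ℝ (Fin d) | R < ‖y‖ ∧ ‖y‖ < 2 * R},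
          ‖iteratedFDeriv ℝ j f y‖ₑ ^ p) ^ (1 / p) +
        (∫⁻ s in Set.Ioc (0 : ℝ) 1,
          ENNReal.ofReal (s ^ n) * ENNReal.ofReal (s ^ d)⁻¹ ^ (1 / p)) *
          (ENNReal.ofReal R ^ (n + 1) *
            (∫⁻ y in {y : EuclideanSpace ℝ (Fin d) | R < ‖y‖ ∧ ‖y‖ < 2 * R},
              ‖iteratedFDeriv ℝ (n + 1) f y‖ₑ ^ p) ^ (1 / p))) := by
  have hR : 0 < R := by linarith [norm_nonneg x]
  have hAm : MeasurableSet {y : EuclideanSpace ℝ (Fin d) | R < ‖y‖ ∧ ‖y‖ < 2 * R} :=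
    (measurableSet_lt measurable_const measurable_norm).inter
      (measurableSet_lt measurable_norm measurable_const)
  set ω := (volume (Metric.ball (0 : EuclideanSpace ℝ (Fin d)) 1)).toReal with hω
  have hω0 : 0 < ω := ENNReal.toReal_pos (Metric.measure_ball_pos _ _ one_pos).ne'
    measure_ball_lt_top.ne
  set B := Metric.ball ((3 / 2 * R / ‖x‖) • x) (R / 2) with hB
  have hvol : volume B = ENNReal.ofReal ((R / 2) ^ d * ω) := by
    rw [hB, Measure.addHaar_ball_of_pos _ _ (by positivity), finrank_euclideanSpace_fin,
      ENNReal.ofReal_mul (by positivity), hω, ENNReal.ofReal_toReal measure_ball_lt_top.ne]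
  have hvol' : volume B ^ (-(1 / p)) =
      ENNReal.ofReal (ω ^ (-(1 / p)) * 2 ^ ((d : ℝ) / p) * R ^ (-((d : ℝ) / p))) := by
    rw [hvol, ENNReal.ofReal_rpow_of_pos (by positivity),
      Real.mul_rpow (by positivity) hω0.le, ← Real.rpow_natCast, ← Real.rpow_mul (by positivity),
      Real.div_rpow hR.le zero_le_two, mul_neg, mul_one_div, Real.rpow_neg zero_le_two]
    congr 1
    field_simp
  have hxB (y : EuclideanSpace ℝ (Fin d)) (hy : y ∈ B) : ‖y - x‖ₑ ≤ ENNReal.ofReal R := by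
    rw [← ofReal_norm]
    exact ENNReal.ofReal_le_ofReal (norm_sub_le_of_mem_ball_annulus hx hx' hy)
  have hmain := enorm_le_measure_rpow_mul_sum_add volume hp hf hAm measurableSet_ball
    (Metric.measure_ball_pos volume _ (half_pos hR)).ne' measure_ball_lt_top.ne hxB
    fun y hy s hs ↦ norm_homothety_mem_annulus hx hx' hy hs
  rwa [finrank_euclideanSpace_fin, hvol'] at hmain

theorem pow_mul_lintegral_annulus_le {F G : Type*} [NormedAddCommGroup F] [NormedAddCommGroup G]
    {d q j M : ℕ} {R p : ℝ} (hR : 0 < R) (hp : 0 < p) {g : EuclideanSpace ℝ (Fin d) → F}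
    {h : EuclideanSpace ℝ (Fin d) → G} (hg : Continuous g) (hM : q + j ≤ M) (a : ℝ)
    (hgh : ∀ y, ‖h y‖ ≤ ‖g y‖) :
    ENNReal.ofReal R ^ j * (∫⁻ y in {y : EuclideanSpace ℝ (Fin d) | R < ‖y‖ ∧ ‖y‖ < 2 * R},
        ‖h y‖ₑ ^ p) ^ (1 / p) ≤
      ENNReal.ofReal (2 ^ (|a| + M) * R ^ (-a - q) *
        (∫ y in {y : EuclideanSpace ℝ (Fin d) | R < ‖y‖ ∧ ‖y‖ < 2 * R},
          (‖y‖ ^ (a + (q + j : ℕ)) * ‖g y‖) ^ p) ^ (1 / p)) := by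
  have e (y : EuclideanSpace ℝ (Fin d)) : ‖h y‖ₑ ^ p ≤ ‖g y‖ₑ ^ p := by
    rw [← ofReal_norm, ← ofReal_norm]
    gcongr
    exact hgh y
  have hw := lintegral_annulus_le_weighted volume hR hp hg (a + (q + j : ℕ))
  set W := (∫ y in {y : EuclideanSpace ℝ (Fin d) | R < ‖y‖ ∧ ‖y‖ < 2 * R},
          (‖y‖ ^ (a + (q + j : ℕ)) * ‖g y‖) ^ p) ^ (1 / p)
  have hW0 : 0 ≤ W := Real.rpow_nonneg (integral_nonneg fun y ↦ by positivity) _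
  have hexp : |a + (q + j : ℕ)| ≤ |a| + M := by
    refine (abs_add_le _ _).trans ?_
    rw [Nat.abs_cast]
    gcongr
  have hRR : R ^ j * R ^ (-(a + (q + j : ℕ))) = R ^ (-a - q) := by
    rw [← Real.rpow_natCast, ← Real.rpow_add hR]
    congr 1
    push_cast
    ring
  grw [lintegral_mono e, hw, ← ENNReal.ofReal_pow hR.le, ← ENNReal.ofReal_mul (by positivity)]
  refine ENNReal.ofReal_le_ofReal ?_
  calc R ^ j * (2 ^ |a + (q + j : ℕ)| * R ^ (-(a + (q + j : ℕ))) * W)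
      = 2 ^ |a + (q + j : ℕ)| * (R ^ j * R ^ (-(a + (q + j : ℕ)))) * W := by ring
    _ ≤ _ := by
      rw [hRR]
      gcongr
      exact one_le_two

theorem exists_weighted_norm_mD_le (d m q : ℕ) (p δ : ℝ) (hp : 1 < p)
    (hq : (q : ℝ) < (m : ℝ) - (d : ℝ) / p) :
    ∃ C : ℝ, 0 < C ∧ ∀ R : ℝ, 0 < R →
      ∀ f : EuclideanSpace ℝ (Fin d) → ℝ, ContDiff ℝ m f →
      ∀ α : Fin d → ℕ, msize α = q → ∀ x : EuclideanSpace ℝ (Fin d), R < ‖x‖ → ‖x‖ < 2 * R →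
        ‖x‖ ^ (δ + (q : ℝ)) * ‖mD α f x‖ ≤
          C * ∑ j ∈ Finset.range (m + 1),
            (∫ y in {y : EuclideanSpace ℝ (Fin d) | R < ‖y‖ ∧ ‖y‖ < 2 * R},
              (‖y‖ ^ (δ - (d : ℝ) / p + (j : ℝ)) * ‖iteratedFDeriv ℝ j f y‖) ^ p) ^ (1 / p) := by
  have hp0 : 0 < p := by linarith
  have hqm : q < m := by
    have : (q : ℝ) < m := by linarith [show 0 ≤ (d : ℝ) / p by positivity]
    exact_mod_cast this
  obtain ⟨n, rfl⟩ : ∃ n, m = q + (n + 1) := ⟨m - q - 1, by omega⟩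
  have hn : (d : ℝ) / p < n + 1 := by push_cast at hq; linarith
  set K := ∫⁻ s in Set.Ioc (0 : ℝ) 1,
      ENNReal.ofReal (s ^ n) * ENNReal.ofReal (s ^ d)⁻¹ ^ (1 / p) with hK
  have hKt : K < ∞ := lintegral_rpow_kernel_lt_top hn hp0
  set ω := (volume (Metric.ball (0 : EuclideanSpace ℝ (Fin d)) 1)).toReal with hω
  have hω0 : 0 < ω := ENNReal.toReal_pos (Metric.measure_ball_pos _ _ one_pos).ne'
    measure_ball_lt_top.ne
  set T : ℝ := 2 ^ (|δ - d / p| + (q + (n + 1) : ℕ)) with hT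
  refine ⟨2 ^ |δ + q| * (ω ^ (-(1 / p)) * 2 ^ ((d : ℝ) / p) * (1 + K.toReal) * T), by positivity,
    fun R hR f hf α hα x hx hx' ↦ ?_⟩
  set A := {y : EuclideanSpace ℝ (Fin d) | R < ‖y‖ ∧ ‖y‖ < 2 * R} with hA
  set W : ℕ → ℝ := fun j ↦ (∫ y in A,
    (‖y‖ ^ (δ - (d : ℝ) / p + (j : ℝ)) * ‖iteratedFDeriv ℝ j f y‖) ^ p) ^ (1 / p) with hW
  have hW0 (j : ℕ) : 0 ≤ W j :=
    Real.rpow_nonneg (integral_nonneg fun y ↦ by positivity) _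
  have hlen := (length_flatMap_replicate α).trans hα
  have hg : ContDiff ℝ (n + 1 : ℕ) (mD α f) := ContDiff.pdList (by rwa [hlen])
  have hbound (j : ℕ) (hj : j ≤ n + 1) (y : EuclideanSpace ℝ (Fin d)) :
      ‖iteratedFDeriv ℝ j (mD α f) y‖ ≤ ‖iteratedFDeriv ℝ (q + j) f y‖ := by
    have h := norm_iteratedFDeriv_pdList_le (n := j) (f := f)
      (l := (List.finRange d).flatMap fun i ↦ List.replicate (α i) i)
      (by rw [hlen]; exact hf.of_le (mod_cast Nat.add_le_add_left hj q)) y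
    rwa [hlen] at h
  set S := ∑ j ∈ Finset.range (q + (n + 1) + 1), W j with hS
  have hterm (j : ℕ) (hj : j ≤ n + 1) :
      ENNReal.ofReal R ^ j * (∫⁻ y in A, ‖iteratedFDeriv ℝ j (mD α f) y‖ₑ ^ p) ^ (1 / p) ≤
        ENNReal.ofReal (T * R ^ (-(δ - (d : ℝ) / p) - q) * W (q + j)) :=
    pow_mul_lintegral_annulus_le hR hp0
      (hf.continuous_iteratedFDeriv (m := q + j) (mod_cast Nat.add_le_add_left hj q))
      (Nat.add_le_add_left hj q) _ (hbound j hj)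
  have hsum : ∑ j ∈ Finset.range (n + 1), W (q + j) ≤ S := by
    have h1 : 0 ≤ ∑ j ∈ Finset.range q, W j := Finset.sum_nonneg fun j _ ↦ hW0 j
    have h2 : S = ∑ j ∈ Finset.range q, W j +
        (∑ j ∈ Finset.range (n + 1), W (q + j) + W (q + (n + 1))) := by
      rw [hS, add_assoc, Finset.sum_range_add, Finset.sum_range_succ _ (n + 1)]
    linarith [hW0 (q + (n + 1))]
  have htop : W (q + (n + 1)) ≤ S :=
    Finset.single_le_sum (fun j _ ↦ hW0 j) (Finset.mem_range.2 (Nat.lt_succ_self _))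
  have hmain := enorm_le_rpow_mul_sum_add_of_mem_annulus hp
    (n := n) (f := mD α f) (mod_cast hg) hx hx'
  rw [← hK, ← hω, ← hA] at hmain
  have hS0 : 0 ≤ S := Finset.sum_nonneg fun j _ ↦ hW0 j
  have hT0 : 0 < T := by positivity
  clear_value S W T K ω A
  have hfin : ‖mD α f x‖ ≤
      (ω ^ (-(1 / p)) * 2 ^ ((d : ℝ) / p) * R ^ (-((d : ℝ) / p))) *
        (T * R ^ (-(δ - (d : ℝ) / p) - q) * S +
          K.toReal * (T * R ^ (-(δ - (d : ℝ) / p) - q) * S)) := by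
    have hb (c b : ℝ) (hc : 0 ≤ c) (hb : 0 ≤ b) : ENNReal.ofReal (c * (b + K.toReal * b)) =
        ENNReal.ofReal c * (ENNReal.ofReal b + K * ENNReal.ofReal b) := by
      rw [ENNReal.ofReal_mul hc, ENNReal.ofReal_add hb (by positivity),
        ENNReal.ofReal_mul (by positivity), ENNReal.ofReal_toReal hKt.ne]
    rw [← ENNReal.ofReal_le_ofReal_iff (by positivity), ofReal_norm, hb _ _ (by positivity)
      (by positivity)]
    refine hmain.trans ?_
    gcongr
    · grw [Finset.sum_le_sum fun j hj ↦ hterm j (Finset.mem_range.1 hj).le]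
      rw [← ENNReal.ofReal_sum_of_nonneg fun j _ ↦ mul_nonneg (by positivity) (hW0 _),
        ← Finset.mul_sum]
      gcongr
    · grw [hterm _ le_rfl]
      gcongr
  have hx2 := Real.rpow_le_two_rpow_abs_mul hR hx.le hx'.le (δ + q)
  have hRR : R ^ (δ + q) * R ^ (-((d : ℝ) / p)) * R ^ (-(δ - (d : ℝ) / p) - q) = 1 := by
    rw [← Real.rpow_add hR, ← Real.rpow_add hR]
    convert Real.rpow_zero R using 2
    ring
  calc _ ≤ (2 ^ |δ + q| * R ^ (δ + q)) *
      ((ω ^ (-(1 / p)) * 2 ^ ((d : ℝ) / p) * R ^ (-((d : ℝ) / p))) *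
        (T * R ^ (-(δ - (d : ℝ) / p) - q) * S +
          K.toReal * (T * R ^ (-(δ - (d : ℝ) / p) - q) * S))) := by gcongr
    _ = 2 ^ |δ + q| * (ω ^ (-(1 / p)) * 2 ^ ((d : ℝ) / p) * (1 + K.toReal) * T) * S *
        (R ^ (δ + q) * R ^ (-((d : ℝ) / p)) * R ^ (-(δ - (d : ℝ) / p) - q)) := by ring
    _ = _ := by rw [hRR, mul_one]

end

/-- Scale-invariant Morrey inequality on the annuli
`A_R = {R < |x| < 2R}`: if `mp > d` and `k < m - d/p`, then for `|α| ≤ k`,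
`sup_{x ∈ A_R} |x|^{δ+|α|} |D^α f(x)| ≤ C Σ_{j≤m} ‖ |x|^{δ-d/p+j} ∇^j f ‖_{L^p(A_R)}`
with `C` independent of `R > 0`. -/
theorem annulus_morrey_inequality
    (d m k : ℕ) (hd : 1 ≤ d) (p δ : ℝ) (hp : 1 < p)
    (hmp : (d : ℝ) < (m : ℝ) * p) (hk : (k : ℝ) < (m : ℝ) - (d : ℝ) / p) :
    ∃ C : ℝ, 0 < C ∧ ∀ R : ℝ, 0 < R →
      ∀ f : EuclideanSpace ℝ (Fin d) → ℝ, ContDiff ℝ m f →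
      ∀ α ∈ mIdx d k, ∀ x : EuclideanSpace ℝ (Fin d), R < ‖x‖ → ‖x‖ < 2 * R →
        ‖x‖ ^ (δ + (msize α : ℝ)) * |mD α f x| ≤
          C * ∑ j ∈ Finset.range (m + 1),
            (∫ y in {y : EuclideanSpace ℝ (Fin d) | R < ‖y‖ ∧ ‖y‖ < 2 * R},
              (‖y‖ ^ (δ - (d : ℝ) / p + (j : ℝ)) * ‖iteratedFDeriv ℝ j f y‖) ^ p) ^ (1 / p) := by
  have hlt (q : ℕ) (hq : q ≤ k) : (q : ℝ) < (m : ℝ) - (d : ℝ) / p :=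
    (Nat.cast_le.2 hq).trans_lt hk
  choose! C hC0 hC using fun q hq ↦
    exists_weighted_norm_mD_le d m q p δ hp (hlt q hq)
  have hC0' (q : ℕ) (hq : q ∈ Finset.range (k + 1)) : 0 < C q :=
    hC0 q (Nat.lt_succ_iff.1 (Finset.mem_range.1 hq))
  refine ⟨∑ q ∈ Finset.range (k + 1), C q,
    Finset.sum_pos hC0' ⟨0, by simp⟩, fun R hR f hf α hα x hx hx' ↦ ?_⟩
  have hαk : msize α ≤ k := (Finset.mem_filter.1 hα).2
  have hle : C (msize α) ≤ ∑ q ∈ Finset.range (k + 1), C q :=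
    Finset.single_le_sum (fun q hq ↦ (hC0' q hq).le) (Finset.mem_range.2 (Nat.lt_succ_iff.2 hαk))
  refine (hC _ hαk R hR f hf α rfl x hx hx').trans ?_
  exact mul_le_mul_of_nonneg_right hle <| Finset.sum_nonneg fun j _ ↦
    Real.rpow_nonneg (integral_nonneg fun y ↦ by positivity) _
end
end

section
/- Let m and ℓ be nonnegative integers with m ≤ ℓ+1, let J ⊂ ℝ be an interval, and let R : J → ℝ be a C^m function satisfying |R^{(j)}(t)| ≤ C₀ |t|^{ℓ+1−j} for all t ∈ J and all integers 0 ≤ j ≤ m. Let K > 0 and let u : ℝ → ℝ be a C^m function with u(x) ∈ J for all x and |u^{(k)}(x)| ≤ K ⟨x⟩^{−k−1} for all x ∈ ℝ and all integers 0 ≤ k ≤ m. Then there exists a constant C = C(m,ℓ,C₀,K) such that |d^k/dx^k [R(u(x))]| ≤ C ⟨x⟩^{−ℓ−1−k} for all x ∈ ℝ and all integers 0 ≤ k ≤ m. -/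
noncomputable section

/-- The sizes of the parts of an ordered finpartition of `Fin n` add up to `n`. -/
lemma OrderedFinpartition.sum_partSize {n : ℕ} (c : OrderedFinpartition n) :
    ∑ j, c.partSize j = n := by
  simpa using Fintype.card_congr c.equivSigma

/-- A nontrivial order-connected set of reals has unique derivatives. -/
lemma Set.OrdConnected.uniqueDiffOn {J : Set ℝ} (hJ : J.OrdConnected) (hnt : J.Nontrivial) :
    UniqueDiffOn ℝ J :=
  uniqueDiffOn_convex hJ.convex (hJ.convex.nontrivial_iff_nonempty_interior.mp hnt)

/-- If the derivatives of `g` at `u x` and of `u` at `x` have homogeneous bounds in a scale `r`, then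
so do those of `g ∘ u`, with a constant counting the terms of the Faà di Bruno formula. -/
lemma abs_iteratedDeriv_comp_le {J : Set ℝ} (hJ : UniqueDiffOn ℝ J) {g u : ℝ → ℝ} {k p : ℕ}
    (hkp : k ≤ p) (hg : ContDiffOn ℝ k g J) (hu : ContDiff ℝ k u) (huJ : ∀ x, u x ∈ J)
    {A K r x : ℝ} (hA : 0 ≤ A) (hK : 0 ≤ K) (hr : 0 < r)
    (hgb : ∀ j ≤ k, |iteratedDerivWithin j g J (u x)| ≤ A * |u x| ^ (p - j))
    (hub : ∀ j ≤ k, |iteratedDeriv j u x| ≤ K / r ^ (j + 1)) :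
    |iteratedDeriv k (fun y => g (u y)) x| ≤
      Fintype.card (OrderedFinpartition k) * (A * K ^ p) / r ^ (p + k) := by
  have hfaa := iteratedDerivWithin_comp_eq_sum_orderedFinpartition
    (hg (u x) (huJ x)) hu.contDiffAt.contDiffWithinAt hJ uniqueDiffOn_univ (Set.mem_univ x)
    (fun y _ => huJ y) le_rfl
  simp only [iteratedDerivWithin_univ] at hfaa
  change |iteratedDeriv k (g ∘ u) x| ≤ _
  rw [hfaa, mul_div_assoc, ← nsmul_eq_mul]
  refine (Finset.abs_sum_le_sum_abs _ _).trans (Finset.sum_le_card_nsmul _ _ _ fun c _ => ?_)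
  have hu0 : |u x| ≤ K / r := by simpa using hub 0 (Nat.zero_le k)
  have hl : c.length ≤ p := c.length_le.trans hkp
  calc |iteratedDerivWithin c.length g J (u x) * ∏ j, iteratedDeriv (c.partSize j) u x|
      ≤ A * (K / r) ^ (p - c.length) * ∏ j, K / r ^ (c.partSize j + 1) := by
        rw [abs_mul, Finset.abs_prod]
        refine mul_le_mul ((hgb _ c.length_le).trans (by gcongr))
          (Finset.prod_le_prod (fun _ _ => abs_nonneg _) fun j _ => hub _ (c.partSize_le j))
          (Finset.prod_nonneg fun _ _ => abs_nonneg _) (by positivity)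
    _ = A * K ^ (p - c.length + c.length) / r ^ (p - c.length + c.length + k) := by
        have hprod : ∏ j, K / r ^ (c.partSize j + 1) = K ^ c.length / r ^ (k + c.length) := by
          rw [Finset.prod_div_distrib, Finset.prod_pow_eq_pow_sum, Finset.sum_add_distrib,
            c.sum_partSize]
          simp
        rw [hprod, div_pow, add_right_comm, add_assoc _ k, pow_add, pow_add]
        field_simp
        ring
    _ = A * K ^ p / r ^ (p + k) := by rw [Nat.sub_add_cancel hl]

/-- Faà-di-Bruno-type decay estimate: if `R` is `C^m` on an interval `J`
with `|R^{(j)}(t)| ≤ C₀|t|^{ℓ+1-j}` on `J` for `j ≤ m ≤ ℓ+1`, and `u : ℝ → ℝ` is `C^m`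
with values in `J` and `|u^{(k)}(x)| ≤ K⟨x⟩^{-k-1}` for `k ≤ m`, then
`|d^k/dx^k R(u(x))| ≤ C⟨x⟩^{-ℓ-1-k}` for `k ≤ m`, with `C = C(m,ℓ,C₀,K)`. -/
theorem remainder_composition_decay_W
    (m ℓ : ℕ) (hml : m ≤ ℓ + 1) (C₀ K : ℝ) (hC₀ : 0 < C₀) (hK : 0 < K) :
    ∃ C : ℝ, 0 < C ∧
      ∀ J : Set ℝ, J.OrdConnected →
      ∀ R : ℝ → ℝ, ContDiffOn ℝ m R J →
        (∀ t ∈ J, ∀ j : ℕ, j ≤ m → |iteratedDerivWithin j R J t| ≤ C₀ * |t| ^ (ℓ + 1 - j)) →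
      ∀ u : ℝ → ℝ, ContDiff ℝ m u → (∀ x, u x ∈ J) →
        (∀ x : ℝ, ∀ k : ℕ, k ≤ m →
          |iteratedDeriv k u x| ≤ K / Real.sqrt (1 + x ^ 2) ^ (k + 1)) →
      ∀ x : ℝ, ∀ k : ℕ, k ≤ m →
        |iteratedDeriv k (fun y => R (u y)) x| ≤ C / Real.sqrt (1 + x ^ 2) ^ (ℓ + 1 + k) := by
  set N : ℝ := ∑ k ∈ Finset.range (m + 1), (Fintype.card (OrderedFinpartition k) : ℝ)
  refine ⟨(1 + N) * (C₀ * K ^ (ℓ + 1)), by positivity, ?_⟩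
  intro J hJ R hR hRb u hu huJ hub x k hk
  set r := Real.sqrt (1 + x ^ 2)
  have hr : 0 < r := Real.sqrt_pos.mpr (by positivity)
  rcases J.subsingleton_or_nontrivial with hs | hnt
  · have hconst : (fun y => R (u y)) = fun _ => R (u x) :=
      funext fun y => congrArg R (hs (huJ y) (huJ x))
    rw [hconst, iteratedDeriv_const]
    split_ifs with h0
    · subst h0
      have hu0 : |u x| ≤ K / r := by simpa using hub x 0 hk
      have hR0 : |R (u x)| ≤ C₀ * |u x| ^ (ℓ + 1) := by simpa using hRb (u x) (huJ x) 0 hk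
      calc |R (u x)| ≤ C₀ * (K / r) ^ (ℓ + 1) := hR0.trans (by gcongr)
        _ = 1 * (C₀ * K ^ (ℓ + 1)) / r ^ (ℓ + 1 + 0) := by
          rw [div_pow, add_zero, one_mul, mul_div_assoc]
        _ ≤ _ := by
          gcongr
          exact le_add_of_nonneg_right (by positivity)
    · rw [abs_zero]
      positivity
  · have hkm : (k : WithTop ℕ∞) ≤ m := by exact_mod_cast hk
    refine (abs_iteratedDeriv_comp_le (hJ.uniqueDiffOn hnt) (hk.trans hml) (hR.of_le hkm)
      (hu.of_le hkm) huJ hC₀.le hK.le hr (fun j hj => hRb _ (huJ x) j (hj.trans hk))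
      fun j hj => hub x j (hj.trans hk)).trans ?_
    gcongr
    have hcard : (Fintype.card (OrderedFinpartition k) : ℝ) ≤ N :=
      Finset.single_le_sum (f := fun k => (Fintype.card (OrderedFinpartition k) : ℝ))
        (fun _ _ => Nat.cast_nonneg _) (Finset.mem_range.mpr (Nat.lt_succ_of_le hk))
    linarith
end
end

section
/- Let m and ℓ be nonnegative integers with m ≤ ℓ+1, let J ⊂ ℝ be an interval, and let R : J → ℝ be a C^m function satisfying |R^{(j)}(t)| ≤ C₀ |t|^{ℓ+1−j} for all t ∈ J and all integers 0 ≤ j ≤ m. Let K > 0 and let u : ℝ → ℝ be a C^m function with u(x) ∈ J for all x and |u^{(k)}(x)| ≤ K ⟨x⟩^{−1} for all x ∈ ℝ and all integers 0 ≤ k ≤ m. Then there exists a constant C = C(m,ℓ,C₀,K) such that |d^k/dx^k [R(u(x))]| ≤ C ⟨x⟩^{−ℓ−1} for all x ∈ ℝ and all integers 0 ≤ k ≤ m. -/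
noncomputable section

open Set

/-- An order-connected set of reals with more than one point has unique derivatives. -/
theorem Set.OrdConnected.uniqueDiffOn_of_nontrivial {J : Set ℝ} (hJ : J.OrdConnected)
    (hJ' : J.Nontrivial) : UniqueDiffOn ℝ J :=
  uniqueDiffOn_convex hJ.convex (hJ.convex.nontrivial_iff_nonempty_interior.1 hJ')

/-- If the derivatives of `u` at `x` up to order `k` are at most `B` and those of `g` at `u x`
satisfy `|g^{(j)}| ≤ A * B ^ (N - j)`, then each summand of the Faà di Bruno formula for the `k`-th
derivative of `g ∘ u` at `x` is at most `A * B ^ N`, and there is one summand per ordered partition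
of `Fin k`. -/
theorem abs_iteratedDeriv_comp_le_card_mul {J : Set ℝ} (hJ : UniqueDiffOn ℝ J) {g u : ℝ → ℝ}
    {k N : ℕ} (hkN : k ≤ N) {A B x : ℝ}
    (hg : ContDiffOn ℝ k g J) (hu : ContDiff ℝ k u) (huJ : ∀ y, u y ∈ J)
    (hgb : ∀ j ≤ k, |iteratedDerivWithin j g J (u x)| ≤ A * B ^ (N - j))
    (hub : ∀ j ≤ k, |iteratedDeriv j u x| ≤ B) :
    |iteratedDeriv k (g ∘ u) x| ≤ Fintype.card (OrderedFinpartition k) * (A * B ^ N) := by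
  have key := iteratedDerivWithin_comp_eq_sum_orderedFinpartition (hg _ (huJ x))
    hu.contDiffWithinAt hJ uniqueDiffOn_univ (mem_univ x) (fun y _ => huJ y) le_rfl
  simp only [iteratedDerivWithin_univ] at key
  rw [key]
  refine (Finset.abs_sum_le_sum_abs _ _).trans ?_
  rw [← nsmul_eq_mul, ← Finset.card_univ]
  refine Finset.sum_le_card_nsmul _ _ _ fun c _ => ?_
  have hprod : |∏ j, iteratedDeriv (c.partSize j) u x| ≤ B ^ c.length := by
    rw [Finset.abs_prod]
    refine (Finset.prod_le_prod (fun _ _ => abs_nonneg _)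
      fun j _ => hub _ (c.partSize_le j)).trans ?_
    simp
  rw [abs_mul]
  calc _ ≤ A * B ^ (N - c.length) * B ^ c.length :=
        mul_le_mul (hgb _ c.length_le) hprod (abs_nonneg _)
          ((abs_nonneg _).trans (hgb _ c.length_le))
    _ = A * B ^ N := by
        rw [mul_assoc, ← pow_add, Nat.sub_add_cancel (c.length_le.trans hkN)]

/-- Faà-di-Bruno-type decay estimate (bounded-derivative variant): if
`R` is `C^m` on an interval `J` with `|R^{(j)}(t)| ≤ C₀|t|^{ℓ+1-j}` on `J` for
`j ≤ m ≤ ℓ+1`, and `u : ℝ → ℝ` is `C^m` with values in `J` and `|u^{(k)}(x)| ≤ K⟨x⟩^{-1}`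
for `k ≤ m`, then `|d^k/dx^k R(u(x))| ≤ C⟨x⟩^{-ℓ-1}` for `k ≤ m`, with `C = C(m,ℓ,C₀,K)`. -/
theorem remainder_composition_decay_H
    (m ℓ : ℕ) (hml : m ≤ ℓ + 1) (C₀ K : ℝ) (hC₀ : 0 < C₀) (hK : 0 < K) :
    ∃ C : ℝ, 0 < C ∧
      ∀ J : Set ℝ, J.OrdConnected →
      ∀ R : ℝ → ℝ, ContDiffOn ℝ m R J →
        (∀ t ∈ J, ∀ j : ℕ, j ≤ m → |iteratedDerivWithin j R J t| ≤ C₀ * |t| ^ (ℓ + 1 - j)) →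
      ∀ u : ℝ → ℝ, ContDiff ℝ m u → (∀ x, u x ∈ J) →
        (∀ x : ℝ, ∀ k : ℕ, k ≤ m →
          |iteratedDeriv k u x| ≤ K / Real.sqrt (1 + x ^ 2)) →
      ∀ x : ℝ, ∀ k : ℕ, k ≤ m →
        |iteratedDeriv k (fun y => R (u y)) x| ≤ C / Real.sqrt (1 + x ^ 2) ^ (ℓ + 1) := by
  refine ⟨(1 + ∑ k ∈ Finset.range (m + 1), (Fintype.card (OrderedFinpartition k) : ℝ)) *
    (C₀ * K ^ (ℓ + 1)), by positivity, fun J hJ R hR hRb u hu huJ hub x k hk => ?_⟩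
  set B := K / Real.sqrt (1 + x ^ 2) with hBdef
  have hux : |u x| ≤ B := by simpa using hub x 0 (Nat.zero_le m)
  have hRb' : ∀ j ≤ m, |iteratedDerivWithin j R J (u x)| ≤ C₀ * B ^ (ℓ + 1 - j) := fun j hj =>
    (hRb _ (huJ x) j hj).trans (by gcongr)
  rw [mul_div_assoc, mul_div_assoc, ← div_pow, ← hBdef]
  have hAB : 0 ≤ C₀ * B ^ (ℓ + 1) := by positivity
  rcases J.subsingleton_or_nontrivial with hJs | hJn
  · have hconst : (fun y => R (u y)) = fun _ => R (u x) :=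
      funext fun y => by rw [hJs (huJ y) (huJ x)]
    have hbound : |iteratedDeriv k (fun y => R (u y)) x| ≤ C₀ * B ^ (ℓ + 1) := by
      rw [hconst, iteratedDeriv_const]
      split_ifs
      · simpa using hRb' 0 (Nat.zero_le m)
      · simpa using hAB
    exact hbound.trans (le_mul_of_one_le_left hAB (le_add_of_nonneg_right (by positivity)))
  · have hkm : (k : WithTop ℕ∞) ≤ m := by exact_mod_cast hk
    refine (abs_iteratedDeriv_comp_le_card_mul (hJ.uniqueDiffOn_of_nontrivial hJn)
      (hk.trans hml) (hR.of_le hkm) (hu.of_le hkm) huJ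
      (fun j hj => hRb' j (hj.trans hk)) fun j hj => hub x j (hj.trans hk)).trans ?_
    refine mul_le_mul_of_nonneg_right ?_ hAB
    have := Finset.single_le_sum (f := fun k => (Fintype.card (OrderedFinpartition k) : ℝ))
      (fun _ _ => Nat.cast_nonneg _) (Finset.mem_range.2 (Nat.lt_succ_of_le hk))
    linarith
end
end
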